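/- Let V be a ℚ-vector space, β : V × V → ℚ a symmetric bilinear form, and write q(v) = β(v,v) for the associated quadratic form. Let A be a commutative ring which is also a ℚ-algebra, let ι : V → A be a ℚ-linear map, and let n ≥ 1 be an integer. Assume that ι(v)^(n+1) = 0 for every v ∈ V with q(v) = 0. Let l, l', σ ∈ V satisfy q(l) = 0, q(l') = 0, q(σ) = 0, β(l,σ) = 0 and β(l',σ) = 0, and let h = a·l + b·l' for scalars a, b ∈ ℚ. Then ι(h)^(2n−2) · ι(σ) = C(2n−2, n−1) · a^(n−1) · b^(n−1) · ι(l)^(n−1) · ι(l')^(n−1) · ι(σ) in A, where C(2n−2, n−1) is the binomial coefficient. -/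

import Mathlib

/-- A polynomial over an infinite field with coefficients in a vector space that vanishes at
every scalar has all its coefficients equal to zero. -/
theorem coeff_eq_zero_of_forall_sum_pow_smul_eq_zero {K M : Type*} [Field K] [Infinite K]
    [AddCommGroup M] [Module K M] {N : ℕ} {c : ℕ → M}
    (hc : ∀ t : K, ∑ k ∈ Finset.range N, t ^ k • c k = 0) {k : ℕ} (hk : k < N) : c k = 0 := by
  rw [← Module.forall_dual_apply_eq_zero_iff K]
  intro f
  have hp : ∑ i ∈ Finset.range N, Polynomial.monomial i (f (c i)) = 0 := by
    refine Polynomial.funext fun t => ?_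
    simpa [Polynomial.eval_finsetSum, mul_comm] using congrArg f (hc t)
  simpa [Polynomial.finsetSum_coeff, Polynomial.coeff_monomial, hk] using
    congrArg (fun p => p.coeff k) hp

/-- If every element `x + t • y` of a line has vanishing `(n + 1)`-st power, then
`x ^ n * y = 0`. -/
theorem pow_mul_eq_zero_of_forall_add_smul_pow_eq_zero {K A : Type*} [Field K] [CharZero K]
    [CommRing A] [Algebra K A] {x y : A} {n : ℕ}
    (h : ∀ t : K, (x + t • y) ^ (n + 1) = 0) : x ^ n * y = 0 := by
  have hc : ∀ t : K, ∑ k ∈ Finset.range (n + 2),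
      t ^ k • (((n + 1).choose k : K) • (y ^ k * x ^ (n + 1 - k))) = 0 := by
    intro t
    rw [← h t, add_comm x, add_pow]
    refine Finset.sum_congr rfl fun k _ => ?_
    simp only [Algebra.smul_def, mul_pow, map_pow, map_natCast]
    ring
  have h1 := coeff_eq_zero_of_forall_sum_pow_smul_eq_zero hc (k := 1) (by omega)
  have hn : ((n + 1 : ℕ) : K) ≠ 0 := Nat.cast_ne_zero.mpr n.succ_ne_zero
  rw [Nat.choose_one_right, smul_eq_zero_iff_right hn] at h1
  simpa [mul_comm] using h1

/-- If `z` is annihilated by `x ^ (m + 1)` and by `y ^ (m + 1)`, only the middle term of the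
binomial expansion of `(a • x + b • y) ^ (2 * m)` survives multiplication by `z`. -/
theorem add_smul_pow_two_mul_mul_eq {K A : Type*} [Field K] [CommRing A] [Algebra K A]
    {x y z : A} {m : ℕ} (hx : x ^ (m + 1) * z = 0) (hy : y ^ (m + 1) * z = 0) (a b : K) :
    (a • x + b • y) ^ (2 * m) * z =
      (((2 * m).choose m : K) * a ^ m * b ^ m) • (x ^ m * y ^ m * z) := by
  have vanish : ∀ {w : A} {j : ℕ}, w ^ (m + 1) * z = 0 → m < j → w ^ j * z = 0 := by
    intro w j hw hj
    rw [← Nat.sub_add_cancel (Nat.succ_le_of_lt hj), pow_add, mul_assoc, hw, mul_zero]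
  rw [add_pow, Finset.sum_mul, Finset.sum_eq_single m]
  · rw [show 2 * m - m = m by omega]
    simp only [Algebra.smul_def, mul_pow, map_mul, map_pow, map_natCast]
    ring
  · intro k _ hkm
    simp only [Algebra.smul_def, mul_pow]
    rcases lt_or_gt_of_ne hkm with hk | hk
    · linear_combination (algebraMap K A a ^ k * x ^ k * algebraMap K A b ^ (2 * m - k) *
        ((2 * m).choose k : A)) * vanish hy (show m < 2 * m - k by omega)
    · linear_combination (algebraMap K A a ^ k * algebraMap K A b ^ (2 * m - k) *
        y ^ (2 * m - k) * ((2 * m).choose k : A)) * vanish hx hk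
  · intro hm
    exact absurd (Finset.mem_range.mpr (by omega)) hm

/-- Equation (1.5): with `l, l', σ` isotropic, `σ` orthogonal to `l` and `l'`,
and `h = a • l + b • l'`, one has
`ι h ^ (2n-2) * ι σ = C(2n-2, n-1) a^(n-1) b^(n-1) ι l^(n-1) ι l'^(n-1) ι σ`. -/
theorem stmt_2 (V : Type*) [AddCommGroup V] [Module ℚ V]
    (β : V →ₗ[ℚ] V →ₗ[ℚ] ℚ) (hβ : ∀ v w : V, β v w = β w v)
    (A : Type*) [CommRing A] [Algebra ℚ A]
    (ι : V →ₗ[ℚ] A) (n : ℕ) (hn : 1 ≤ n)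
    (hfujiki : ∀ v : V, β v v = 0 → ι v ^ (n + 1) = 0)
    (l l' σ : V) (hl : β l l = 0) (hl' : β l' l' = 0) (hσ : β σ σ = 0)
    (hlσ : β l σ = 0) (hl'σ : β l' σ = 0)
    (a b : ℚ) (h : V) (hh : h = a • l + b • l') :
    ι h ^ (2 * n - 2) * ι σ =
      (((2 * n - 2).choose (n - 1) : ℚ) * a ^ (n - 1) * b ^ (n - 1)) •
        (ι l ^ (n - 1) * ι l' ^ (n - 1) * ι σ) := by
  have key : ∀ u : V, β u u = 0 → β u σ = 0 → ι u ^ n * ι σ = 0 := by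
    intro u hu huσ
    refine pow_mul_eq_zero_of_forall_add_smul_pow_eq_zero (K := ℚ) fun t => ?_
    rw [← map_smul, ← map_add]
    apply hfujiki
    simp [hu, huσ, hβ σ u, hσ]
  obtain ⟨m, rfl⟩ := Nat.exists_eq_add_of_le' hn
  rw [hh, map_add, map_smul, map_smul, Nat.add_sub_cancel,
    show 2 * (m + 1) - 2 = 2 * m by omega]
  exact add_smul_pow_two_mul_mul_eq (key l hl hlσ) (key l' hl' hl'σ) a b
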